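/- Let n ≥ 3 be a prime power. The map (i,j,k) ↦ i(n^3−n^2+n) + j·n^3 − k(n^3+1) is a bijection from T(n) onto the gap set G(n) = ℕ \ S(n); in particular G(n) = { i(n^3−n^2+n) + j·n^3 − k(n^3+1) : (i,j,k) ∈ T(n) }. -/

import Mathlib

/-- Membership condition for the index set `T(n)` of triples `(i,j,k)` indexing the
functions `y^i z^j / x^k` on the GK curve. -/
def memT (n i j k : ℤ) : Prop :=
  0 ≤ i ∧ i ≤ n ∧ 0 ≤ j ∧ j ≤ n ^ 2 - n ∧ 1 ≤ k ∧ k ≤ n ^ 2 - 1 ∧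
  (1 ≤ k ∧ k ≤ n - 1 →
    ((0 ≤ i ∧ i ≤ k ∧ k - i + 1 ≤ j ∧ j ≤ n ^ 2 - n) ∨
     (k + 1 ≤ i ∧ i ≤ n ∧ 0 ≤ j ∧ j ≤ n ^ 2 - n))) ∧
  (n ≤ k ∧ k ≤ n ^ 2 - n - 2 → k - i + 1 ≤ j ∧ j ≤ n ^ 2 - n) ∧
  (n ^ 2 - n - 1 ≤ k ∧ k ≤ n ^ 2 - 1 →
    (k - n ^ 2 + n + 1 ≤ i ∧ i ≤ n ∧ k - i + 1 ≤ j ∧ j ≤ n ^ 2 - n))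

/-- The set `T(n)` of triples `(i, j, k)`. -/
def T (n : ℤ) : Set (ℤ × ℤ × ℤ) := {x | memT n x.1 x.2.1 x.2.2}

/-- The map `γ(i,j,k) = (k(n^3+1) − i(n^2−n+1) − j, i(n^3−n^2+n) + j n^3 − k(n^3+1))`,
the pair of pole orders at `P₀` and `P∞` of `y^i z^j / x^k`. -/
def gammaMap (n : ℤ) (x : ℤ × ℤ × ℤ) : ℤ × ℤ :=
  (x.2.2 * (n ^ 3 + 1) - x.1 * (n ^ 2 - n + 1) - x.2.1,
   x.1 * (n ^ 3 - n ^ 2 + n) + x.2.1 * n ^ 3 - x.2.2 * (n ^ 3 + 1))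

/-- The gap set `G(n) = ℕ \ S(n)` (viewed inside `ℤ`) of the numerical semigroup `S(n)`
generated by `n^3 − n^2 + n`, `n^3` and `n^3 + 1`. -/
def Ggaps (n : ℤ) : Set ℤ :=
  {m | 0 ≤ m ∧ ¬ ∃ a b c : ℕ,
    m = (a : ℤ) * (n ^ 3 - n ^ 2 + n) + (b : ℤ) * n ^ 3 + (c : ℤ) * (n ^ 3 + 1)}

/-- `T(n)` is a box cut by the single inequality `k + 1 ≤ i + j`. -/
theorem memT_iff' (n i j k : ℤ) : memT n i j k ↔
    0 ≤ i ∧ i ≤ n ∧ 0 ≤ j ∧ j ≤ n ^ 2 - n ∧ 1 ≤ k ∧ k + 1 ≤ i + j := by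
  unfold memT
  generalize n ^ 2 = N
  constructor
  · rintro ⟨h1, h2, h3, h4, h5, h6, h7, h8, h9⟩
    refine ⟨h1, h2, h3, h4, h5, ?_⟩
    by_cases ha : k ≤ n - 1
    · rcases h7 ⟨h5, ha⟩ with h | h <;> omega
    · by_cases hb : k ≤ N - n - 2
      · have := h8 ⟨by omega, hb⟩
        omega
      · have := h9 ⟨by omega, h6⟩
        omega
  · intro h
    refine ⟨by omega, by omega, by omega, by omega, by omega, by omega, ?_, ?_, ?_⟩ <;> omega

/-- A nonnegative combination equal to a box element has coefficient of `n^3+1` no larger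
than that of the box element. -/
theorem key (n i j d a b c : ℤ) (hn : 3 ≤ n) (hi : i ≤ n) (hj : j ≤ n ^ 2 - n)
    (ha : 0 ≤ a) (hb : 0 ≤ b)
    (h : a * (n ^ 3 - n ^ 2 + n) + b * n ^ 3 + c * (n ^ 3 + 1) =
      i * (n ^ 3 - n ^ 2 + n) + j * n ^ 3 + d * (n ^ 3 + 1)) :
    ∃ s r : ℤ, 0 ≤ s ∧ 0 ≤ r ∧ b = j + (n ^ 2 - n + 1) * s ∧ a + s = i + (n + 1) * r ∧
      r * n + s * (n ^ 2 - n) + c = d := by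
  have hq : 0 < n ^ 2 - n + 1 := by nlinarith
  obtain ⟨s, hs⟩ : (n ^ 2 - n + 1) ∣ b - j :=
    ⟨(a - i) * n + (b - j) * (n + 1) + (c - d) * (n + 1), by linear_combination -h⟩
  have hs0 : 0 ≤ s := by
    by_contra hc
    have : s ≤ -1 := by omega
    nlinarith
  have h2 : (a - i) * n + s * n ^ 3 + (c - d) * (n + 1) = 0 := by
    apply mul_left_cancel₀ hq.ne'
    linear_combination h - n ^ 3 * hs
  obtain ⟨r, hr⟩ : (n + 1) ∣ a + s - i :=
    ⟨a - i + s * (n ^ 2 - n + 1) + (c - d), by linear_combination -h2⟩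
  have hr0 : 0 ≤ r := by
    by_contra hc
    have : r ≤ -1 := by omega
    nlinarith
  refine ⟨s, r, hs0, hr0, by linarith, by linarith, ?_⟩
  apply mul_left_cancel₀ (show n + 1 ≠ 0 by omega)
  linear_combination h2 - n * hr

/-- Every integer has a representation with coefficients in the box. -/
theorem box_rep (n m : ℤ) (hn : 3 ≤ n) : ∃ i j d : ℤ, 0 ≤ i ∧ i ≤ n ∧ 0 ≤ j ∧ j ≤ n ^ 2 - n ∧
    m = i * (n ^ 3 - n ^ 2 + n) + j * n ^ 3 + d * (n ^ 3 + 1) := by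
  have hq : 0 < n ^ 2 - n + 1 := by nlinarith
  have e1 := Int.emod_add_mul_ediv (-m) (n ^ 2 - n + 1)
  have p1 := Int.emod_nonneg (-m) hq.ne'
  have l1 := Int.emod_lt_of_pos (-m) hq
  set j := (-m) % (n ^ 2 - n + 1)
  set u := (-m) / (n ^ 2 - n + 1)
  have hq2 : 0 < n + 1 := by omega
  have e2 := Int.emod_add_mul_ediv (u + j * (n + 1)) (n + 1)
  have p2 := Int.emod_nonneg (u + j * (n + 1)) hq2.ne'
  have l2 := Int.emod_lt_of_pos (u + j * (n + 1)) hq2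
  set i := (u + j * (n + 1)) % (n + 1)
  set v := (u + j * (n + 1)) / (n + 1)
  refine ⟨i, j, -v - i, p2, by omega, p1, by omega, ?_⟩
  linear_combination e1 + (n ^ 2 - n + 1) * e2

/-- for a prime power `n ≥ 3`, the map
`(i,j,k) ↦ i(n^3−n^2+n) + j n^3 − k(n^3+1)` is a bijection from `T(n)` onto the gap set
`G(n)`; in particular `G(n)` is the image of `T(n)` under this map. -/
theorem second_coord_bijOn (n : ℕ) (hn : 3 ≤ n) (hpp : IsPrimePow n) :
    Set.BijOn
      (fun x : ℤ × ℤ × ℤ =>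
        x.1 * ((n : ℤ) ^ 3 - n ^ 2 + n) + x.2.1 * (n : ℤ) ^ 3 - x.2.2 * ((n : ℤ) ^ 3 + 1))
      (T (n : ℤ)) (Ggaps (n : ℤ)) ∧
    Ggaps (n : ℤ) =
      (fun x : ℤ × ℤ × ℤ =>
        x.1 * ((n : ℤ) ^ 3 - n ^ 2 + n) + x.2.1 * (n : ℤ) ^ 3 - x.2.2 * ((n : ℤ) ^ 3 + 1)) ''
        T (n : ℤ) := by
  have hn' : (3 : ℤ) ≤ (n : ℤ) := by exact_mod_cast hn
  generalize (n : ℤ) = N at hn'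
  have hbij : Set.BijOn
      (fun x : ℤ × ℤ × ℤ =>
        x.1 * (N ^ 3 - N ^ 2 + N) + x.2.1 * N ^ 3 - x.2.2 * (N ^ 3 + 1))
      (T N) (Ggaps N) := by
    refine ⟨?_, ?_, ?_⟩
    · rintro ⟨i, j, k⟩ hx
      obtain ⟨h1, h2, h3, h4, h5, h6⟩ := (memT_iff' N i j k).1 hx
      refine ⟨?_, ?_⟩
      · have e1 : 0 ≤ (i + j - k - 1) * (N ^ 3 - 1) :=
          mul_nonneg (by omega) (by nlinarith [sq_nonneg N])
        have e2 : 0 ≤ (N - i) * (N ^ 2 - N) := mul_nonneg (by omega) (by nlinarith)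
        show 0 ≤ i * (N ^ 3 - N ^ 2 + N) + j * N ^ 3 - k * (N ^ 3 + 1)
        nlinarith
      · rintro ⟨a, b, c, h⟩
        obtain ⟨s, r, hs, hr, -, -, e⟩ := key N i j (-k) a b c hn' h2 h4 (by positivity)
          (by positivity) (by simp only at h; linear_combination -h)
        have : 0 ≤ r * N := mul_nonneg hr (by omega)
        have : 0 ≤ s * (N ^ 2 - N) := mul_nonneg hs (by nlinarith)
        omega
    · rintro ⟨i, j, k⟩ hx ⟨i', j', k'⟩ hx' h
      obtain ⟨h1, h2, h3, h4, h5, h6⟩ := (memT_iff' N i j k).1 hx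
      obtain ⟨g1, g2, g3, g4, g5, g6⟩ := (memT_iff' N i' j' k').1 hx'
      simp only at h
      obtain ⟨s, r, hs, hr, eb, ea, e⟩ := key N i' j' (-k') i j (-k) hn' g2 g4 h1 h3
        (by linear_combination h)
      have hs0 : s = 0 := by
        by_contra hc
        have : 1 ≤ s := by omega
        nlinarith
      subst hs0
      have hr0 : r = 0 := by
        by_contra hc
        have : 1 ≤ r := by omega
        nlinarith
      subst hr0
      simp only [Prod.mk.injEq]
      refine ⟨by linarith, by linarith, by linarith⟩
    · rintro m ⟨hm, hns⟩
      obtain ⟨i, j, d, h1, h2, h3, h4, h⟩ := box_rep N m hn'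
      have hd : d < 0 := by
        by_contra hc
        push Not at hc
        exact hns ⟨i.toNat, j.toNat, d.toNat, by
          rw [Int.toNat_of_nonneg h1, Int.toNat_of_nonneg h3, Int.toNat_of_nonneg hc]; exact h⟩
      refine ⟨(i, j, -d), (memT_iff' N i j (-d)).2 ⟨h1, h2, h3, h4, by omega, ?_⟩, ?_⟩
      · by_contra hc
        have e1 : 0 ≤ (-d - i - j) * N ^ 3 := mul_nonneg (by omega) (by positivity)
        have e2 : 0 ≤ i * (N ^ 2 - N) := mul_nonneg h1 (by nlinarith)
        nlinarith
      · show i * (N ^ 3 - N ^ 2 + N) + j * N ^ 3 - (-d) * (N ^ 3 + 1) = m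
        linear_combination -h
  exact ⟨hbij, hbij.image_eq.symm⟩
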